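/- The map H : SP → ℓ² defined by H(μ) := (∫ h_i dμ)_{i≥1} is well defined (its values are square-summable), injective, and is a homeomorphism from SP (with the vague topology) onto its range H(SP) ⊆ ℓ² endowed with the ℓ²-norm subspace topology. In particular, H(SP) is a compact (hence closed) subset of ℓ². -/

import Mathlib

open MeasureTheory Topology Filter

noncomputable section

/-- Euclidean space `ℝ^d`. -/
abbrev Rd (d : ℕ) := Fin d → ℝ

/-- The space of subprobability measures on `ℝ^d`. -/
def SP (d : ℕ) : Type := {μ : Measure (Rd d) // μ Set.univ ≤ 1}

/-- The vague topology on `SP d`: the initial topology of the maps `μ ↦ ∫ g dμ` for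
`g : ℝ^d → ℝ` continuous with compact support. -/
instance (d : ℕ) : TopologicalSpace (SP d) :=
  ⨅ g : {g : Rd d → ℝ // Continuous g ∧ HasCompactSupport g},
    TopologicalSpace.induced (fun μ : SP d => ∫ x, g.1 x ∂μ.1) inferInstance

instance (d : ℕ) : MeasurableSpace (SP d) := borel (SP d)
instance (d : ℕ) : BorelSpace (SP d) := ⟨rfl⟩

/-- First-order partial derivative `∂_i f`. -/
def pd {n : ℕ} (f : (Fin n → ℝ) → ℝ) (i : Fin n) (x : Fin n → ℝ) : ℝ :=
  fderiv ℝ f x (Pi.single i 1)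

/-- Second-order partial derivative `∂²_{ij} f`. -/
def pd2 {n : ℕ} (f : (Fin n → ℝ) → ℝ) (i j : Fin n) (x : Fin n → ℝ) : ℝ :=
  fderiv ℝ (fun y => pd f j y) x (Pi.single i 1)

/-- Twice continuously differentiable with compact support. -/
def IsC2c {n : ℕ} (φ : (Fin n → ℝ) → ℝ) : Prop :=
  ContDiff ℝ 2 φ ∧ HasCompactSupport φ

/-- Twice continuously differentiable, bounded, with bounded first and second order
partial derivatives. -/
def IsC2b {n : ℕ} (f : (Fin n → ℝ) → ℝ) : Prop :=
  ContDiff ℝ 2 f ∧ ∃ M : ℝ, ∀ x, |f x| ≤ M ∧ (∀ i, |pd f i x| ≤ M) ∧ ∀ i j, |pd2 f i j x| ≤ M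

/-- `φ` and `ψ` are uniformly `ε`-close, together with their first and second order
partial derivatives (closeness in the `C²_b` norm). -/
def C2Close {n : ℕ} (φ ψ : (Fin n → ℝ) → ℝ) (ε : ℝ) : Prop :=
  (∀ x, |φ x - ψ x| ≤ ε) ∧ (∀ i x, |pd φ i x - pd ψ i x| ≤ ε) ∧
  ∀ i j x, |pd2 φ i j x - pd2 ψ i j x| ≤ ε

/-- A countable family `g i ∈ C²_c(ℝ^d) \ {0}` which is dense in `C²_c(ℝ^d)` with respect
to the `C²_b` norm. -/
def GFamily (d : ℕ) (g : ℕ → Rd d → ℝ) : Prop :=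
  (∀ i, IsC2c (g i)) ∧ (∀ i, g i ≠ 0) ∧
  ∀ φ : Rd d → ℝ, IsC2c φ → ∀ ε : ℝ, 0 < ε → ∃ i, C2Close (g i) φ ε

/-- The global chart `G : SP → ℝ^∞`, `G(μ) = (μ(g_i))_i`. -/
def Gmap {d : ℕ} (g : ℕ → Rd d → ℝ) (μ : SP d) : ℕ → ℝ := fun i => ∫ x, g i x ∂μ.1

/-- The `C²_b`-norm `max(‖φ‖_∞, ‖∂_iφ‖_∞, ‖∂²_{ij}φ‖_∞)`. -/
def c2bNorm {d : ℕ} (φ : Rd d → ℝ) : ℝ :=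
  ⨆ x : Rd d, max |φ x| (max (⨆ i, |pd φ i x|) (⨆ i, ⨆ j, |pd2 φ i j x|))

/-- The renormalized family `h_i := 2^{-(i+1)} g_i / ‖g_i‖_{C²_b}`. -/
def hfun {d : ℕ} (g : ℕ → Rd d → ℝ) (i : ℕ) : Rd d → ℝ :=
  fun x => (2 : ℝ)⁻¹ ^ (i + 1) * (g i x / c2bNorm (g i))

/-- The Hilbert space `ℓ²` of square-summable real sequences. -/
abbrev E2 : Type := lp (fun _ : ℕ => ℝ) 2

instance : MeasurableSpace E2 := borel E2
instance : BorelSpace E2 := ⟨rfl⟩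

section

variable {d : ℕ}

lemma SP.isFiniteMeasure (μ : SP d) : IsFiniteMeasure μ.1 :=
  ⟨μ.2.trans_lt ENNReal.one_lt_top⟩

lemma SP.measureReal_univ_le_one (μ : SP d) : μ.1.real Set.univ ≤ 1 :=
  ENNReal.toReal_le_of_le_ofReal zero_le_one (by simpa using μ.2)

lemma SP.norm_integral_le {f : Rd d → ℝ} {C : ℝ} (hf : ∀ x, |f x| ≤ C) (μ : SP d) :
    ‖∫ x, f x ∂μ.1‖ ≤ C := by
  have := μ.isFiniteMeasure
  have hC : 0 ≤ C := (abs_nonneg _).trans (hf 0)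
  calc ‖∫ x, f x ∂μ.1‖ ≤ C * μ.1.real Set.univ :=
        norm_integral_le_of_norm_le_const (ae_of_all _ hf)
    _ ≤ C * 1 := by gcongr; exact μ.measureReal_univ_le_one
    _ = C := mul_one C

lemma SP.continuous_integral {f : Rd d → ℝ} (hf : Continuous f) (hf' : HasCompactSupport f) :
    Continuous fun μ : SP d => ∫ x, f x ∂μ.1 :=
  continuous_iff_le_induced.2
    (iInf_le _ (⟨f, hf, hf'⟩ : {g : Rd d → ℝ // Continuous g ∧ HasCompactSupport g}))

lemma SP.le_nhds_of_tendsto_integral {l : Filter (SP d)} {μ : SP d}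
    (h : ∀ f : Rd d → ℝ, Continuous f → HasCompactSupport f →
      Tendsto (fun ν : SP d => ∫ x, f x ∂ν.1) l (𝓝 (∫ x, f x ∂μ.1))) : l ≤ 𝓝 μ := by
  rw [nhds_iInf]
  refine le_iInf fun f => ?_
  rw [nhds_induced]
  exact (h f.1 f.2.1 f.2.2).le_comap

open scoped ContDiff in
/-- Two finite measures with the same integrals of smooth compactly supported functions agree. -/
lemma MeasureTheory.Measure.ext_of_integral_contDiff {E : Type*} [NormedAddCommGroup E]
    [NormedSpace ℝ E] [FiniteDimensional ℝ E] [MeasurableSpace E] [BorelSpace E]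
    {μ ν : Measure E} [IsFiniteMeasure μ] [IsFiniteMeasure ν]
    (h : ∀ f : E → ℝ, ContDiff ℝ ∞ f → HasCompactSupport f → ∫ x, f x ∂μ = ∫ x, f x ∂ν) :
    μ = ν := by
  have hμ : μ ≪ μ + ν := Measure.absolutelyContinuous_of_le (Measure.le_add_right le_rfl)
  have hν : ν ≪ μ + ν := Measure.absolutelyContinuous_of_le (Measure.le_add_left le_rfl)
  have key : ∀ᵐ x ∂(μ + ν), (μ.rnDeriv (μ + ν) x).toReal = (ν.rnDeriv (μ + ν) x).toReal := by
    refine ae_eq_of_integral_contDiff_smul_eq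
      Measure.integrable_toReal_rnDeriv.locallyIntegrable
      Measure.integrable_toReal_rnDeriv.locallyIntegrable fun f hf hf' => ?_
    simp only [smul_eq_mul, mul_comm (f _)]
    rw [integral_toReal_rnDeriv_mul hμ, integral_toReal_rnDeriv_mul hν]
    exact h f hf hf'
  calc μ = (μ + ν).withDensity (μ.rnDeriv (μ + ν)) := (Measure.withDensity_rnDeriv_eq _ _ hμ).symm
    _ = (μ + ν).withDensity (ν.rnDeriv (μ + ν)) := by
      refine withDensity_congr_ae ?_
      filter_upwards [key, μ.rnDeriv_lt_top (μ + ν), ν.rnDeriv_lt_top (μ + ν)] with x hx h1 h2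
      exact (ENNReal.toReal_eq_toReal_iff' h1.ne h2.ne).1 hx
    _ = ν := Measure.withDensity_rnDeriv_eq _ _ hν

lemma IsC2c.pd {φ : Rd d → ℝ} (hφ : IsC2c φ) (i : Fin d) :
    ContDiff ℝ 1 (pd φ i) ∧ HasCompactSupport (pd φ i) :=
  ⟨(hφ.1.fderiv_right (by norm_num)).clm_apply contDiff_const, hφ.2.fderiv_apply ℝ _⟩

lemma IsC2c.pd2 {φ : Rd d → ℝ} (hφ : IsC2c φ) (i j : Fin d) :
    Continuous (pd2 φ i j) ∧ HasCompactSupport (pd2 φ i j) :=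
  ⟨((hφ.pd j).1.continuous_fderiv one_ne_zero).clm_apply continuous_const,
    (hφ.pd j).2.fderiv_apply ℝ _⟩

lemma IsC2c.isC2b {φ : Rd d → ℝ} (hφ : IsC2c φ) : IsC2b φ := by
  obtain ⟨A, hA⟩ := hφ.1.continuous.bounded_above_of_compact_support hφ.2
  choose B hB using fun i =>
    (hφ.pd i).1.continuous.bounded_above_of_compact_support (hφ.pd i).2
  choose C hC using fun i j =>
    (hφ.pd2 i j).1.bounded_above_of_compact_support (hφ.pd2 i j).2
  have hB0 i : 0 ≤ B i := (norm_nonneg _).trans (hB i 0)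
  have hC0 i j : 0 ≤ C i j := (norm_nonneg _).trans (hC i j 0)
  have hA0 : 0 ≤ A := (norm_nonneg _).trans (hA 0)
  have hBs : 0 ≤ ∑ i, B i := Finset.sum_nonneg fun i _ => hB0 i
  have hCs : 0 ≤ ∑ i, ∑ j, C i j :=
    Finset.sum_nonneg fun i _ => Finset.sum_nonneg fun j _ => hC0 i j
  refine ⟨hφ.1, A + ∑ i, B i + ∑ i, ∑ j, C i j, fun x => ⟨?_, fun i => ?_, fun i j => ?_⟩⟩
  · have := hA x
    rw [Real.norm_eq_abs] at this
    linarith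
  · have h1 := hB i x
    have h2 := Finset.single_le_sum (fun i _ => hB0 i) (Finset.mem_univ i)
    rw [Real.norm_eq_abs] at h1
    linarith
  · have h1 := hC i j x
    have h2 := Finset.single_le_sum (fun j _ => hC0 i j) (Finset.mem_univ j)
    have h3 := Finset.single_le_sum (f := fun i => ∑ j, C i j)
      (fun i _ => Finset.sum_nonneg fun j _ => hC0 i j) (Finset.mem_univ i)
    rw [Real.norm_eq_abs] at h1
    linarith

lemma IsC2c.abs_le_c2bNorm {φ : Rd d → ℝ} (hφ : IsC2c φ) (x : Rd d) : |φ x| ≤ c2bNorm φ := by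
  obtain ⟨M, hM⟩ := hφ.isC2b.2
  have hM0 : 0 ≤ M := (abs_nonneg _).trans (hM 0).1
  have hbdd : BddAbove (Set.range fun x : Rd d =>
      max |φ x| (max (⨆ i, |_root_.pd φ i x|) (⨆ i, ⨆ j, |_root_.pd2 φ i j x|))) := by
    refine ⟨M, ?_⟩
    rintro _ ⟨y, rfl⟩
    exact max_le (hM y).1 (max_le (Real.iSup_le (hM y).2.1 hM0)
      (Real.iSup_le (fun i => Real.iSup_le ((hM y).2.2 i) hM0) hM0))
  exact (le_max_left _ _).trans (le_ciSup hbdd x)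

lemma IsC2c.c2bNorm_pos {φ : Rd d → ℝ} (hφ : IsC2c φ) (h0 : φ ≠ 0) : 0 < c2bNorm φ := by
  obtain ⟨x, hx⟩ := Function.ne_iff.1 h0
  exact (abs_pos.2 hx).trans_le (hφ.abs_le_c2bNorm x)

variable {g : ℕ → Rd d → ℝ}

lemma GFamily.abs_hfun_le (hg : GFamily d g) (i : ℕ) (x : Rd d) :
    |hfun g i x| ≤ (2 : ℝ)⁻¹ ^ (i + 1) := by
  have hpos := (hg.1 i).c2bNorm_pos (hg.2.1 i)
  rw [hfun, abs_mul, abs_div, abs_of_pos hpos, abs_of_pos (by positivity : (0 : ℝ) < 2⁻¹ ^ (i + 1))]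
  exact mul_le_of_le_one_right (by positivity)
    ((div_le_one hpos).2 ((hg.1 i).abs_le_c2bNorm x))

lemma integral_hfun (i : ℕ) (μ : SP d) :
    ∫ x, hfun g i x ∂μ.1 = (2 : ℝ)⁻¹ ^ (i + 1) * ((∫ x, g i x ∂μ.1) / c2bNorm (g i)) := by
  simp only [hfun, integral_const_mul, integral_div]

lemma summable_inv_two_pow_succ : Summable fun i : ℕ => (2 : ℝ)⁻¹ ^ (i + 1) :=
  (summable_nat_add_iff 1).2 (summable_geometric_of_lt_one (by norm_num) (by norm_num))

lemma GFamily.memℓp (hg : GFamily d g) (μ : SP d) :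
    Memℓp (fun i => ∫ x, hfun g i x ∂μ.1) 2 := by
  refine Memℓp.of_exponent_ge (q := 1) (memℓp_gen ?_) one_le_two
  simpa using summable_inv_two_pow_succ.of_nonneg_of_le (fun i => norm_nonneg _)
    (fun i => SP.norm_integral_le (hg.abs_hfun_le i) μ)

/-- The map `H(μ) = (μ(h_i))_i` into `ℓ²`. -/
def Hmap (hg : GFamily d g) (μ : SP d) : E2 := ⟨_, hg.memℓp μ⟩

lemma continuous_Hmap (hg : GFamily d g) : Continuous (Hmap hg) := by
  have hsum : Hmap hg = fun μ : SP d =>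
      ∑' i, lp.single (E := fun _ : ℕ => ℝ) 2 i (∫ x, hfun g i x ∂μ.1) := by
    funext μ
    exact (lp.hasSum_single ENNReal.ofNat_ne_top (Hmap hg μ)).tsum_eq.symm
  rw [hsum]
  refine continuous_tsum (fun i => ?_) summable_inv_two_pow_succ fun i μ => ?_
  · refine (lp.singleContinuousAddMonoidHom (fun _ : ℕ => ℝ) 2 i).continuous_toFun.comp ?_
    simp only [integral_hfun]
    exact continuous_const.mul
      ((SP.continuous_integral (hg.1 i).1.continuous (hg.1 i).2).div_const _)
  · rw [lp.norm_single (by norm_num)]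
    exact SP.norm_integral_le (hg.abs_hfun_le i) μ

lemma GFamily.ext_of_integral_eq (hg : GFamily d g) {μ ν : SP d}
    (h : ∀ i, ∫ x, g i x ∂μ.1 = ∫ x, g i x ∂ν.1) : μ = ν := by
  have := μ.isFiniteMeasure
  have := ν.isFiniteMeasure
  refine Subtype.ext (Measure.ext_of_integral_contDiff fun f hf hf' => ?_)
  have hfc : IsC2c f := ⟨contDiff_infty.1 hf 2, hf'⟩
  refine eq_of_abs_sub_le_all fun ε hε => ?_
  obtain ⟨i, hi⟩ := hg.2.2 f hfc (ε / 2) (half_pos hε)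
  have key (ρ : SP d) : |∫ x, g i x ∂ρ.1 - ∫ x, f x ∂ρ.1| ≤ ε / 2 := by
    have := ρ.isFiniteMeasure
    rw [← integral_sub ((hg.1 i).1.continuous.integrable_of_hasCompactSupport (hg.1 i).2)
      (hf.continuous.integrable_of_hasCompactSupport hf')]
    exact SP.norm_integral_le hi.1 ρ
  have h1 := abs_le.1 (key μ)
  have h2 := abs_le.1 (key ν)
  rw [h i] at h1
  exact abs_le.2 ⟨by linarith, by linarith⟩

lemma Hmap_injective (hg : GFamily d g) : Function.Injective (Hmap hg) := by
  intro μ ν hμν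
  refine hg.ext_of_integral_eq fun i => ?_
  have hi : ∫ x, hfun g i x ∂μ.1 = ∫ x, hfun g i x ∂ν.1 :=
    congrFun (congrArg (fun a : E2 => (a : ℕ → ℝ)) hμν) i
  have hpos := (hg.1 i).c2bNorm_pos (hg.2.1 i)
  rw [integral_hfun, integral_hfun] at hi
  exact (div_left_inj' hpos.ne').1 (mul_left_cancel₀ (by positivity) hi)

open scoped CompactlySupported in
/-- The subprobability measures on `ℝ^d` form a compact space in the vague topology. -/
instance SP.compactSpace : CompactSpace (SP d) := by
  refine ⟨isCompact_iff_ultrafilter_le_nhds.2 fun U _ => ?_⟩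
  have hlim (f : C_c(Rd d, ℝ)) :
      ∃ a : ℝ, Tendsto (fun μ : SP d => ∫ x, f x ∂μ.1) U (𝓝 a) := by
    obtain ⟨C, hC⟩ := f.continuous.bounded_above_of_compact_support f.hasCompactSupport
    obtain ⟨a, -, ha⟩ := (isCompact_Icc (a := -C) (b := C)).ultrafilter_le_nhds
      (U.map fun μ : SP d => ∫ x, f x ∂μ.1)
      (le_principal_iff.2 (Filter.mem_map.2 (univ_mem' fun μ =>
        abs_le.1 (SP.norm_integral_le hC μ))))
    exact ⟨a, ha⟩
  choose Λ hΛ using hlim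
  have hint (f : C_c(Rd d, ℝ)) (μ : SP d) : Integrable f μ.1 :=
    have := μ.isFiniteMeasure
    f.continuous.integrable_of_hasCompactSupport f.hasCompactSupport
  let L : C_c(Rd d, ℝ) →ₚ[ℝ] ℝ :=
    { toFun := Λ
      map_add' := fun f f' => tendsto_nhds_unique (hΛ (f + f'))
        (((hΛ f).add (hΛ f')).congr fun μ => (integral_add (hint f μ) (hint f' μ)).symm)
      map_smul' := fun c f => tendsto_nhds_unique (hΛ (c • f))
        (((hΛ f).const_mul c).congr fun μ => (integral_const_mul c _).symm)
      monotone' := fun f f' hff' => le_of_tendsto_of_tendsto' (hΛ f) (hΛ f')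
        fun μ => integral_mono (hint f μ) (hint f' μ) hff' }
  have hmass : RealRMK.rieszMeasure L Set.univ ≤ 1 := by
    rw [isOpen_univ.measure_eq_iSup_isCompact]
    refine iSup₂_le fun K _ => iSup_le fun hK => ?_
    obtain ⟨f, hf1, -, hfc, hf01⟩ := exists_continuous_one_zero_of_isCompact hK
      isClosed_empty (Set.disjoint_empty K)
    let F : C_c(Rd d, ℝ) := ⟨f, hfc⟩
    refine (RealRMK.rieszMeasure_le_of_eq_one L (f := F) (fun x => (hf01 x).1) hK hf1).trans ?_
    refine ENNReal.ofReal_le_one.2 (le_of_tendsto' (hΛ F) fun μ => ?_)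
    exact (le_abs_self _).trans (SP.norm_integral_le
      (fun x => abs_le.2 ⟨by linarith [(hf01 x).1], (hf01 x).2⟩) μ)
  refine ⟨⟨RealRMK.rieszMeasure L, hmass⟩, Set.mem_univ _,
    SP.le_nhds_of_tendsto_integral fun f hf hf' => ?_⟩
  have hL := RealRMK.integral_rieszMeasure L ⟨⟨f, hf⟩, hf'⟩
  exact (hΛ ⟨⟨f, hf⟩, hf'⟩).trans_eq (congrArg 𝓝 hL.symm)

end

/-- Lemma 4.4(ii): the map `H : SP → ℓ²`, `H(μ) = (μ(h_i))_i`, is well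
defined, injective, and a homeomorphism from `SP` (vague topology) onto its range with the
`ℓ²`-norm subspace topology; in particular `H(SP)` is compact, hence closed, in `ℓ²`. -/
theorem Hmap_homeomorphism_onto_range (d : ℕ) (g : ℕ → Rd d → ℝ) (hg : GFamily d g) :
    (∀ μ : SP d, Memℓp (fun i => ∫ x, hfun g i x ∂μ.1) 2) ∧
    ∃ H : SP d → E2,
      (∀ (μ : SP d) (i : ℕ), (H μ : ℕ → ℝ) i = ∫ x, hfun g i x ∂μ.1) ∧
      Function.Injective H ∧
      (∃ hom : SP d ≃ₜ Set.range H, ∀ μ : SP d, (hom μ : E2) = H μ) ∧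
      IsCompact (Set.range H) ∧ IsClosed (Set.range H) := by
  have hemb := (continuous_Hmap hg).isClosedEmbedding (Hmap_injective hg)
  exact ⟨hg.memℓp, Hmap hg, fun _ _ => rfl, Hmap_injective hg,
    ⟨hemb.isEmbedding.toHomeomorph, fun _ => rfl⟩,
    isCompact_range (continuous_Hmap hg), hemb.isClosed_range⟩
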